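/- Let y_F be the uniform circular chain of N atoms with nearest-neighbor spacing Fε. Suppose φ is three times continuously differentiable on (0,∞), γ₂ := min{ φ''(F) + 4 φ''(2F), (φ'(F) + 2 φ'(2F))/F } > 0, and C_φ > 0 satisfies, with F₂ = F cos(πε), max{ |φ''(2F₂) − φ''(2F)|, |φ'(2F₂)/(2F₂) − φ'(2F)/(2F)| } ≤ C_φ ε². Set C₁ = max{ |φ''(2F)|, |φ'(2F)/(2F)|, 4π² |φ''(2F) − φ'(2F)/(2F)| + 12 C_φ }, C₂ = 4π C_φ, and C_κ = 4 C_φ (1 + π² ε²) F + 2π² |φ'(2F)|. Given f ∈ 𝒰, let u^a, u^CB ∈ 𝒰 satisfy δE^a(y_F)[v] + δ²E^a(y_F)[u^a, v] = ⟨f, v⟩ and δE^CB(y_F)[v] + δ²E^CB(y_F)[u^CB, v] = ⟨f, v⟩, respectively, for all v ∈ 𝒰. Then ‖(u^a − u^CB)'‖_{ℓ²_ε} ≤ γ₂^{−1} [ C_κ ε² + (C₁ ε² + C₂ ε⁴)( ‖(u^a)'''‖_{ℓ²_ε} + ‖(u^a)''‖_{ℓ²_ε} + ‖(u^a)'‖_{ℓ²_ε}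 ) ]. -/

import Mathlib

noncomputable section

open Real Finset

/-- Euclidean norm on `ℝ × ℝ`. -/
def enorm2 (v : ℝ × ℝ) : ℝ := Real.sqrt (v.1 ^ 2 + v.2 ^ 2)

/-- Euclidean dot product on `ℝ × ℝ`. -/
def edot (v w : ℝ × ℝ) : ℝ := v.1 * w.1 + v.2 * w.2

/-- `N`-periodic mean-zero displacements (the space `𝒰`). -/
def IsDisp (N : ℕ) (u : ℤ → ℝ × ℝ) : Prop :=
  (∀ ℓ : ℤ, u (ℓ + (N : ℤ)) = u ℓ) ∧ ∑ ℓ ∈ Finset.Icc (1 : ℤ) (N : ℤ), u ℓ = 0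

/-- Constrained displacements (the space `𝒰̃`): second component vanishes. -/
def IsDisp1D (N : ℕ) (u : ℤ → ℝ × ℝ) : Prop :=
  IsDisp N u ∧ ∀ ℓ : ℤ, (u ℓ).2 = 0

/-- Backward difference `u'_ℓ = (u_ℓ - u_{ℓ-1})/ε`. -/
def bd (ε : ℝ) (u : ℤ → ℝ × ℝ) (ℓ : ℤ) : ℝ × ℝ := ε⁻¹ • (u ℓ - u (ℓ - 1))

/-- The inner product `⟨v,w⟩ = ε ∑_{ℓ=1}^N v_ℓ · w_ℓ`. -/
def ip (N : ℕ) (ε : ℝ) (v w : ℤ → ℝ × ℝ) : ℝ :=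
  ε * ∑ ℓ ∈ Finset.Icc (1 : ℤ) (N : ℤ), edot (v ℓ) (w ℓ)

/-- The norm `‖v‖_{ℓ²_ε}`. -/
def nrm (N : ℕ) (ε : ℝ) (v : ℤ → ℝ × ℝ) : ℝ :=
  Real.sqrt (ε * ∑ ℓ ∈ Finset.Icc (1 : ℤ) (N : ℤ), (enorm2 (v ℓ)) ^ 2)

/-- The atomistic energy `E^a`. -/
def Ea (N : ℕ) (ε : ℝ) (φ : ℝ → ℝ) (y : ℤ → ℝ × ℝ) : ℝ :=
  ε * ∑ ℓ ∈ Finset.Icc (1 : ℤ) (N : ℤ),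
    (φ (enorm2 (bd ε y ℓ)) + φ (enorm2 (bd ε y (ℓ + 1) + bd ε y ℓ)))

/-- The Cauchy–Born energy `E^CB`. -/
def ECB (N : ℕ) (ε : ℝ) (φ : ℝ → ℝ) (y : ℤ → ℝ × ℝ) : ℝ :=
  ε * ∑ ℓ ∈ Finset.Icc (1 : ℤ) (N : ℤ),
    (φ (enorm2 (bd ε y ℓ)) + φ (2 * enorm2 (bd ε y ℓ)))

/-- The bond-angle energy `E^b`. -/
def Eb (N : ℕ) (ε α : ℝ) (y : ℤ → ℝ × ℝ) : ℝ :=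
  ε * ∑ ℓ ∈ Finset.Icc (1 : ℤ) (N : ℤ),
    α * (1 - edot (bd ε y (ℓ + 1)) (bd ε y ℓ) /
      (enorm2 (bd ε y (ℓ + 1)) * enorm2 (bd ε y ℓ)))

/-- The quasi-nonlocal energy `E^QNL`. -/
def EQNL (N K : ℕ) (ε : ℝ) (φ : ℝ → ℝ) (y : ℤ → ℝ × ℝ) : ℝ :=
  ε * ∑ ℓ ∈ Finset.Icc (1 : ℤ) (N : ℤ), φ (enorm2 (bd ε y ℓ))
  + ε * ∑ ℓ ∈ Finset.Icc (1 : ℤ) (K : ℤ), φ (enorm2 (bd ε y (ℓ + 1) + bd ε y ℓ))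
  + ε * ∑ ℓ ∈ Finset.Icc ((K : ℤ) + 2) (N : ℤ), φ (2 * enorm2 (bd ε y ℓ))
  + ε / 2 * φ (2 * enorm2 (bd ε y 1)) + ε / 2 * φ (2 * enorm2 (bd ε y ((K : ℤ) + 1)))

/-- First variation `δE(y)[u] = (d/dt) E(y + t u) |_{t=0}`. -/
def dE (E : (ℤ → ℝ × ℝ) → ℝ) (y u : ℤ → ℝ × ℝ) : ℝ :=
  deriv (fun t : ℝ => E (fun ℓ => y ℓ + t • u ℓ)) 0

/-- Second variation `δ²E(y)[u,v] = (∂²/∂t∂s) E(y + t u + s v) |_{t=s=0}`. -/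
def d2E (E : (ℤ → ℝ × ℝ) → ℝ) (y u v : ℤ → ℝ × ℝ) : ℝ :=
  deriv (fun s : ℝ => deriv (fun t : ℝ => E (fun ℓ => y ℓ + t • u ℓ + s • v ℓ)) 0) 0

/-- The linear chain `y_{F,ℓ} = (Fεℓ, 0)`. -/
def yLin (ε F : ℝ) : ℤ → ℝ × ℝ := fun ℓ => (F * ε * ℓ, 0)

/-- The uniform circular chain of radius `R = Fε/(2 sin(πε))`. -/
def yCirc (ε F : ℝ) : ℤ → ℝ × ℝ := fun ℓ =>
  (F * ε / (2 * Real.sin (π * ε)) * Real.cos (2 * π * ε * ℓ),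
   F * ε / (2 * Real.sin (π * ε)) * Real.sin (2 * π * ε * ℓ))

lemma shift_sum (N : ℕ) (g : ℤ → ℝ) (hg : ∀ ℓ : ℤ, g (ℓ + (N : ℤ)) = g ℓ) :
    ∑ ℓ ∈ Finset.Icc (1 : ℤ) (N : ℤ), g (ℓ + 1) = ∑ ℓ ∈ Finset.Icc (1 : ℤ) (N : ℤ), g ℓ := by
  have key : ∀ n : ℕ, ∑ ℓ ∈ Finset.Icc (1 : ℤ) (n : ℤ), g (ℓ + 1)
      = ∑ ℓ ∈ Finset.Icc (1 : ℤ) (n : ℤ), g ℓ + (g ((n : ℤ) + 1) - g 1) := by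
    intro n
    induction n with
    | zero => simp
    | succ k ih =>
      have h : Finset.Icc (1 : ℤ) ((k + 1 : ℕ) : ℤ)
          = insert ((k : ℤ) + 1) (Finset.Icc (1 : ℤ) (k : ℤ)) := by
        ext x; simp only [Finset.mem_Icc, Finset.mem_insert]; push_cast; omega
      rw [h, Finset.sum_insert (by simp), Finset.sum_insert (by simp), ih]
      push_cast
      ring
  rw [key N, add_comm (N : ℤ) 1, hg 1]
  ring

lemma enorm2_nonneg (v : ℝ × ℝ) : 0 ≤ enorm2 v := Real.sqrt_nonneg _

lemma enorm2_sq (v : ℝ × ℝ) : enorm2 v ^ 2 = v.1 ^ 2 + v.2 ^ 2 :=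
  Real.sq_sqrt (by positivity)

lemma nrm_nonneg (N : ℕ) (ε : ℝ) (v : ℤ → ℝ × ℝ) : 0 ≤ nrm N ε v := Real.sqrt_nonneg _

lemma nrm_sq (N : ℕ) (ε : ℝ) (hε : 0 ≤ ε) (v : ℤ → ℝ × ℝ) :
    nrm N ε v ^ 2 = ε * ∑ ℓ ∈ Finset.Icc (1 : ℤ) (N : ℤ), (enorm2 (v ℓ)) ^ 2 :=
  Real.sq_sqrt (mul_nonneg hε (Finset.sum_nonneg fun _ _ => by positivity))

lemma nrm_shift (N : ℕ) (ε : ℝ) (v : ℤ → ℝ × ℝ) (hv : ∀ ℓ : ℤ, v (ℓ + (N : ℤ)) = v ℓ) :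
    nrm N ε (fun ℓ => v (ℓ + 1)) = nrm N ε v := by
  unfold nrm
  rw [shift_sum N (fun ℓ => enorm2 (v ℓ) ^ 2) (fun ℓ => by simp only [hv])]

lemma cs_bound (N : ℕ) (ε : ℝ) (hε : 0 ≤ ε) (c : ℝ) (hc : 0 ≤ c) (g : ℤ → ℝ)
    (p q : ℤ → ℝ × ℝ) (h : ∀ ℓ, |g ℓ| ≤ c * (enorm2 (p ℓ) * enorm2 (q ℓ))) :
    |ε * ∑ ℓ ∈ Finset.Icc (1 : ℤ) (N : ℤ), g ℓ| ≤ c * (nrm N ε p * nrm N ε q) := by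
  set S := Finset.Icc (1 : ℤ) (N : ℤ)
  have h1 : |∑ ℓ ∈ S, g ℓ| ≤ c * ∑ ℓ ∈ S, enorm2 (p ℓ) * enorm2 (q ℓ) := by
    rw [Finset.mul_sum]
    exact (Finset.abs_sum_le_sum_abs _ _).trans (Finset.sum_le_sum fun ℓ _ => h ℓ)
  have h2 : ε * ∑ ℓ ∈ S, enorm2 (p ℓ) * enorm2 (q ℓ) ≤ nrm N ε p * nrm N ε q := by
    refine le_of_sq_le_sq ?_ (mul_nonneg (nrm_nonneg _ _ _) (nrm_nonneg _ _ _))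
    rw [mul_pow (nrm N ε p), nrm_sq N ε hε, nrm_sq N ε hε]
    have := Finset.sum_mul_sq_le_sq_mul_sq S (fun ℓ => enorm2 (p ℓ)) (fun ℓ => enorm2 (q ℓ))
    calc _ = ε ^ 2 * (∑ ℓ ∈ S, enorm2 (p ℓ) * enorm2 (q ℓ)) ^ 2 := by ring
      _ ≤ ε ^ 2 * ((∑ ℓ ∈ S, enorm2 (p ℓ) ^ 2) * ∑ ℓ ∈ S, enorm2 (q ℓ) ^ 2) := by gcongr
      _ = _ := by ring
  rw [abs_mul, abs_of_nonneg hε]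
  calc ε * |∑ ℓ ∈ S, g ℓ| ≤ ε * (c * ∑ ℓ ∈ S, enorm2 (p ℓ) * enorm2 (q ℓ)) := by gcongr
    _ = c * (ε * ∑ ℓ ∈ S, enorm2 (p ℓ) * enorm2 (q ℓ)) := by ring
    _ ≤ _ := by gcongr

/-- gradient of a bond -/
def Gb (φ : ℝ → ℝ) (p q : ℝ × ℝ) : ℝ := deriv φ (enorm2 p) * (edot p q / enorm2 p)

/-- Hessian of a bond -/
def Kb (φ : ℝ → ℝ) (p q r : ℝ × ℝ) : ℝ :=
  deriv (deriv φ) (enorm2 p) * (edot p r / enorm2 p) * (edot p q / enorm2 p)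
  + deriv φ (enorm2 p) *
    ((edot q r * enorm2 p - edot p q * (edot p r / enorm2 p)) / enorm2 p ^ 2)

lemma hasDeriv_enorm2 (p q : ℝ × ℝ) (hp : 0 < enorm2 p) :
    HasDerivAt (fun t : ℝ => enorm2 (p + t • q)) (edot p q / enorm2 p) 0 := by
  have hp' : p.1 ^ 2 + p.2 ^ 2 ≠ 0 := by
    intro h; simp [enorm2, h] at hp
  have h1 : HasDerivAt (fun t : ℝ => (p.1 + t * q.1) ^ 2 + (p.2 + t * q.2) ^ 2)
      (2 * edot p q) 0 := by
    have ha : HasDerivAt (fun t : ℝ => p.1 + t * q.1) q.1 0 := by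
      simpa using ((hasDerivAt_id (0 : ℝ)).mul_const q.1).const_add p.1
    have hb : HasDerivAt (fun t : ℝ => p.2 + t * q.2) q.2 0 := by
      simpa using ((hasDerivAt_id (0 : ℝ)).mul_const q.2).const_add p.2
    refine ((ha.pow 2).add (hb.pow 2)).congr_deriv ?_
    simp [edot]; ring
  have h2 := h1.sqrt (by simpa using hp')
  refine h2.congr_deriv ?_
  simp only [zero_mul, add_zero, enorm2]
  rw [mul_div_mul_left _ _ two_ne_zero]

lemma bond1 (φ : ℝ → ℝ) (hφ : ContDiffOn ℝ 3 φ (Set.Ioi 0)) (p q : ℝ × ℝ) (hp : 0 < enorm2 p) :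
    HasDerivAt (fun t : ℝ => φ (enorm2 (p + t • q))) (Gb φ p q) 0 := by
  have h1 : DifferentiableAt ℝ φ (enorm2 p) :=
    (hφ.contDiffAt (Ioi_mem_nhds hp)).differentiableAt (by norm_num)
  have h2 : HasDerivAt φ (deriv φ (enorm2 p)) (enorm2 (p + (0 : ℝ) • q)) := by
    simpa using h1.hasDerivAt
  exact h2.comp (0 : ℝ) (hasDeriv_enorm2 p q hp)

lemma bond2 (φ : ℝ → ℝ) (hφ : ContDiffOn ℝ 3 φ (Set.Ioi 0)) (p q r : ℝ × ℝ)
    (hp : 0 < enorm2 p) :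
    HasDerivAt (fun s : ℝ => Gb φ (p + s • r) q) (Kb φ p q r) 0 := by
  have h0 : ContDiffOn ℝ 2 (deriv φ) (Set.Ioi 0) :=
    hφ.deriv_of_isOpen isOpen_Ioi (by norm_num)
  have h1 : DifferentiableAt ℝ (deriv φ) (enorm2 p) :=
    (h0.contDiffAt (Ioi_mem_nhds hp)).differentiableAt (by norm_num)
  have h2 : HasDerivAt (deriv φ) (deriv (deriv φ) (enorm2 p)) (enorm2 (p + (0 : ℝ) • r)) := by
    simpa using h1.hasDerivAt
  have h3 := h2.comp (0 : ℝ) (hasDeriv_enorm2 p r hp)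
  have h4 : HasDerivAt (fun s : ℝ => edot (p + s • r) q) (edot q r) 0 := by
    have : (fun s : ℝ => edot (p + s • r) q) = fun s => edot p q + s * edot q r := by
      funext s; simp [edot]; ring
    rw [this]
    simpa using ((hasDerivAt_id (0 : ℝ)).mul_const (edot q r)).const_add (edot p q)
  have h5 := h3.mul (h4.div (hasDeriv_enorm2 p r hp) (by simpa using hp.ne'))
  refine h5.congr_deriv ?_
  simp [Kb]

lemma ev_pos (p r : ℝ × ℝ) (hp : 0 < enorm2 p) :
    ∀ᶠ s : ℝ in nhds 0, 0 < enorm2 (p + s • r) := by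
  have h := (hasDeriv_enorm2 p r hp).continuousAt
  exact h.eventually (by simpa using lt_mem_nhds hp)

lemma var1 (S : Finset ℤ) (ε : ℝ) (φ : ℝ → ℝ) (hφ : ContDiffOn ℝ 3 φ (Set.Ioi 0))
    (E : (ℤ → ℝ × ℝ) → ℝ) (A B : (ℤ → ℝ × ℝ) → ℤ → ℝ × ℝ)
    (hE : ∀ y, E y = ε * ∑ ℓ ∈ S, (φ (enorm2 (A y ℓ)) + φ (enorm2 (B y ℓ))))
    (hA : ∀ (y u : ℤ → ℝ × ℝ) (t : ℝ) (ℓ : ℤ), A (fun k => y k + t • u k) ℓ = A y ℓ + t • A u ℓ)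
    (hB : ∀ (y u : ℤ → ℝ × ℝ) (t : ℝ) (ℓ : ℤ), B (fun k => y k + t • u k) ℓ = B y ℓ + t • B u ℓ)
    (y u : ℤ → ℝ × ℝ) (hpA : ∀ ℓ ∈ S, 0 < enorm2 (A y ℓ)) (hpB : ∀ ℓ ∈ S, 0 < enorm2 (B y ℓ)) :
    dE E y u = ε * ∑ ℓ ∈ S, (Gb φ (A y ℓ) (A u ℓ) + Gb φ (B y ℓ) (B u ℓ)) := by
  unfold dE
  simp only [hE, hA, hB]
  apply HasDerivAt.deriv
  apply HasDerivAt.const_mul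
  apply HasDerivAt.fun_sum
  intro ℓ hℓ
  exact (bond1 φ hφ _ _ (hpA ℓ hℓ)).add (bond1 φ hφ _ _ (hpB ℓ hℓ))

lemma var2 (S : Finset ℤ) (ε : ℝ) (φ : ℝ → ℝ) (hφ : ContDiffOn ℝ 3 φ (Set.Ioi 0))
    (E : (ℤ → ℝ × ℝ) → ℝ) (A B : (ℤ → ℝ × ℝ) → ℤ → ℝ × ℝ)
    (hE : ∀ y, E y = ε * ∑ ℓ ∈ S, (φ (enorm2 (A y ℓ)) + φ (enorm2 (B y ℓ))))
    (hA : ∀ (y u : ℤ → ℝ × ℝ) (t : ℝ) (ℓ : ℤ), A (fun k => y k + t • u k) ℓ = A y ℓ + t • A u ℓ)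
    (hB : ∀ (y u : ℤ → ℝ × ℝ) (t : ℝ) (ℓ : ℤ), B (fun k => y k + t • u k) ℓ = B y ℓ + t • B u ℓ)
    (y u v : ℤ → ℝ × ℝ) (hpA : ∀ ℓ ∈ S, 0 < enorm2 (A y ℓ)) (hpB : ∀ ℓ ∈ S, 0 < enorm2 (B y ℓ)) :
    d2E E y u v = ε * ∑ ℓ ∈ S, (Kb φ (A y ℓ) (A u ℓ) (A v ℓ) + Kb φ (B y ℓ) (B u ℓ) (B v ℓ)) := by
  have hev : ∀ᶠ s : ℝ in nhds 0, deriv (fun t : ℝ => E (fun ℓ => y ℓ + t • u ℓ + s • v ℓ)) 0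
      = ε * ∑ ℓ ∈ S, (Gb φ (A y ℓ + s • A v ℓ) (A u ℓ) + Gb φ (B y ℓ + s • B v ℓ) (B u ℓ)) := by
    have h1 : ∀ᶠ s : ℝ in nhds 0, ∀ ℓ ∈ S, 0 < enorm2 (A y ℓ + s • A v ℓ) :=
      (Filter.eventually_all_finset S).2 fun ℓ hℓ => ev_pos _ _ (hpA ℓ hℓ)
    have h2 : ∀ᶠ s : ℝ in nhds 0, ∀ ℓ ∈ S, 0 < enorm2 (B y ℓ + s • B v ℓ) :=
      (Filter.eventually_all_finset S).2 fun ℓ hℓ => ev_pos _ _ (hpB ℓ hℓ)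
    filter_upwards [h1, h2] with s h1 h2
    have h3 := var1 S ε φ hφ E A B hE hA hB (fun k => y k + s • v k) u
      (by simpa only [hA] using h1) (by simpa only [hB] using h2)
    simp only [hA, hB] at h3
    rw [← h3]
    unfold dE
    congr 1
    funext t
    congr 1
    funext ℓ
    exact add_right_comm _ _ _
  unfold d2E
  rw [Filter.EventuallyEq.deriv_eq hev]
  apply HasDerivAt.deriv
  apply HasDerivAt.const_mul
  apply HasDerivAt.fun_sum
  intro ℓ hℓ
  exact (bond2 φ hφ _ _ _ (hpA ℓ hℓ)).add (bond2 φ hφ _ _ _ (hpB ℓ hℓ))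

/-- tangential component -/
def tq (θ : ℝ) (q : ℝ × ℝ) : ℝ := -Real.sin θ * q.1 + Real.cos θ * q.2
/-- normal component -/
def nq (θ : ℝ) (q : ℝ × ℝ) : ℝ := Real.cos θ * q.1 + Real.sin θ * q.2
/-- quadratic form in a rotated frame -/
def Hf (θ a b : ℝ) (q r : ℝ × ℝ) : ℝ := a * (tq θ q * tq θ r) + b * (nq θ q * nq θ r)

/-- tangent vector -/
def tv (θ : ℝ) : ℝ × ℝ := (-Real.sin θ, Real.cos θ)

lemma enorm2_tv (ρ θ : ℝ) (hρ : 0 < ρ) : enorm2 (ρ • tv θ) = ρ := by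
  unfold enorm2 tv
  rw [Real.sqrt_eq_iff_mul_self_eq (by positivity) hρ.le]
  simp
  linear_combination (ρ ^ 2) * Real.sin_sq_add_cos_sq θ

lemma Gb_tv (φ : ℝ → ℝ) (ρ θ : ℝ) (hρ : 0 < ρ) (q : ℝ × ℝ) :
    Gb φ (ρ • tv θ) q = deriv φ ρ * tq θ q := by
  unfold Gb
  rw [enorm2_tv ρ θ hρ]
  congr 1
  simp [edot, tv, tq]
  field_simp

lemma Kb_tv (φ : ℝ → ℝ) (ρ θ : ℝ) (hρ : 0 < ρ) (q r : ℝ × ℝ) :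
    Kb φ (ρ • tv θ) q r = Hf θ (deriv (deriv φ) ρ) (deriv φ ρ / ρ) q r := by
  unfold Kb Hf
  rw [enorm2_tv ρ θ hρ]
  have h : ∀ q, edot (ρ • tv θ) q = ρ * tq θ q := by
    intro q; simp [edot, tv, tq]; ring
  have h2 : edot q r = tq θ q * tq θ r + nq θ q * nq θ r := by
    simp only [edot, tq, nq]
    linear_combination (-(q.1 * r.1 + q.2 * r.2)) * Real.sin_sq_add_cos_sq θ
  rw [h, h, h2]
  field_simp
  ring

lemma tn_sq (θ : ℝ) (q : ℝ × ℝ) : tq θ q ^ 2 + nq θ q ^ 2 = enorm2 q ^ 2 := by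
  rw [enorm2_sq]; unfold tq nq
  linear_combination (q.1 ^ 2 + q.2 ^ 2) * Real.sin_sq_add_cos_sq θ

lemma tq_le (θ : ℝ) (q : ℝ × ℝ) : |tq θ q| ≤ enorm2 q :=
  abs_le_of_sq_le_sq (by nlinarith [tn_sq θ q, sq_nonneg (nq θ q)]) (enorm2_nonneg q)

lemma Hf_le (θ a b m : ℝ) (ha : |a| ≤ m) (hb : |b| ≤ m) (q r : ℝ × ℝ) :
    |Hf θ a b q r| ≤ m * (enorm2 q * enorm2 r) := by
  have hm : 0 ≤ m := (abs_nonneg a).trans ha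
  have h1 : |tq θ q| * |tq θ r| + |nq θ q| * |nq θ r| ≤ enorm2 q * enorm2 r := by
    refine le_of_sq_le_sq ?_ (mul_nonneg (enorm2_nonneg q) (enorm2_nonneg r))
    rw [mul_pow, ← tn_sq θ q, ← tn_sq θ r, ← sq_abs (tq θ q), ← sq_abs (tq θ r),
      ← sq_abs (nq θ q), ← sq_abs (nq θ r)]
    nlinarith [sq_nonneg (|tq θ q| * |nq θ r| - |nq θ q| * |tq θ r|)]
  unfold Hf
  calc _ ≤ |a * (tq θ q * tq θ r)| + |b * (nq θ q * nq θ r)| := abs_add_le _ _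
    _ = |a| * (|tq θ q| * |tq θ r|) + |b| * (|nq θ q| * |nq θ r|) := by simp only [abs_mul]
    _ ≤ m * (|tq θ q| * |tq θ r|) + m * (|nq θ q| * |nq θ r|) := by gcongr
    _ = m * (|tq θ q| * |tq θ r| + |nq θ q| * |nq θ r|) := by ring
    _ ≤ _ := by gcongr

lemma Hf_ge (θ a b m : ℝ) (ha : m ≤ a) (hb : m ≤ b) (q : ℝ × ℝ) :
    m * enorm2 q ^ 2 ≤ Hf θ a b q q := by
  rw [← tn_sq θ q]; unfold Hf
  nlinarith [mul_nonneg (sub_nonneg.2 ha) (sq_nonneg (tq θ q)),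
    mul_nonneg (sub_nonneg.2 hb) (sq_nonneg (nq θ q))]

lemma enorm2_add_le (p q : ℝ × ℝ) : enorm2 (p + q) ≤ enorm2 p + enorm2 q := by
  have hp := enorm2_nonneg p
  have hq := enorm2_nonneg q
  have h1 : p.1 * q.1 + p.2 * q.2 ≤ enorm2 p * enorm2 q := by
    refine le_of_sq_le_sq ?_ (mul_nonneg hp hq)
    rw [mul_pow, enorm2_sq, enorm2_sq]
    nlinarith [sq_nonneg (p.1 * q.2 - p.2 * q.1)]
  refine le_of_sq_le_sq ?_ (add_nonneg hp hq)
  have e1 := enorm2_sq p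
  have e2 := enorm2_sq q
  rw [enorm2_sq]
  simp only [Prod.fst_add, Prod.snd_add]
  nlinarith

lemma enorm2_smul (c : ℝ) (p : ℝ × ℝ) : enorm2 (c • p) = |c| * enorm2 p := by
  have h : 0 ≤ |c| * enorm2 p := mul_nonneg (abs_nonneg _) (enorm2_nonneg p)
  unfold enorm2 at *
  rw [Real.sqrt_eq_iff_mul_self_eq (by positivity) h]
  have := Real.mul_self_sqrt (show 0 ≤ p.1 ^ 2 + p.2 ^ 2 by positivity)
  have hc := abs_mul_abs_self c
  simp only [Prod.smul_fst, Prod.smul_snd, smul_eq_mul]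
  generalize √(p.1 ^ 2 + p.2 ^ 2) = z at *
  generalize |c| = d at *
  linear_combination (-(d * d)) * this - (p.1 ^ 2 + p.2 ^ 2) * hc

lemma bd_per (N : ℕ) (ε : ℝ) (u : ℤ → ℝ × ℝ) (hu : ∀ ℓ : ℤ, u (ℓ + (N : ℤ)) = u ℓ) (ℓ : ℤ) :
    bd ε u (ℓ + (N : ℤ)) = bd ε u ℓ := by
  unfold bd
  rw [hu, show ℓ + (N : ℤ) - 1 = (ℓ - 1) + (N : ℤ) by ring, hu]

lemma bd_lin (ε : ℝ) (y u : ℤ → ℝ × ℝ) (t : ℝ) (ℓ : ℤ) :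
    bd ε (fun k => y k + t • u k) ℓ = bd ε y ℓ + t • bd ε u ℓ := by
  ext <;> simp [bd] <;> ring

lemma bd_circ (ε F : ℝ) (hε : ε ≠ 0) (hs : Real.sin (π * ε) ≠ 0) (ℓ : ℤ) :
    bd ε (yCirc ε F) ℓ = F • tv (2 * π * ε * ℓ - π * ε) := by
  set β := 2 * π * ε * ℓ - π * ε with hβ
  have h1 : 2 * π * ε * ℓ = β + π * ε := by rw [hβ]; ring
  have h2 : 2 * π * ε * ((ℓ - 1 : ℤ) : ℝ) = β - π * ε := by rw [hβ]; push_cast; ring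
  unfold bd yCirc tv
  rw [h1, h2]
  ext
  · simp only [Prod.smul_fst, Prod.fst_sub, smul_eq_mul, Real.cos_add, Real.cos_sub]
    generalize π * ε = α at *
    field_simp
    ring
  · simp only [Prod.smul_snd, Prod.snd_sub, smul_eq_mul, Real.sin_add, Real.sin_sub]
    generalize π * ε = α at *
    field_simp
    ring

lemma bd_circ2 (ε F : ℝ) (hε : ε ≠ 0) (hs : Real.sin (π * ε) ≠ 0) (ℓ : ℤ) :
    bd ε (yCirc ε F) (ℓ + 1) + bd ε (yCirc ε F) ℓ
      = (2 * (F * Real.cos (π * ε))) • tv (2 * π * ε * ℓ) := by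
  rw [bd_circ ε F hε hs, bd_circ ε F hε hs]
  have h1 : 2 * π * ε * ((ℓ + 1 : ℤ) : ℝ) - π * ε = 2 * π * ε * ℓ + π * ε := by push_cast; ring
  rw [h1]
  ext
  · simp only [tv, Prod.smul_fst, Prod.fst_add, smul_eq_mul, Real.sin_add, Real.sin_sub]
    ring
  · simp only [tv, Prod.smul_snd, Prod.snd_add, smul_eq_mul, Real.cos_add, Real.cos_sub]
    ring

lemma two_enorm2 (p : ℝ × ℝ) : 2 * enorm2 p = enorm2 (p + p) := by
  rw [← two_smul ℝ p, enorm2_smul]; simp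

/-- cross form -/
def Xf (θ : ℝ) (q r : ℝ × ℝ) : ℝ := tq θ q * nq θ r + nq θ q * tq θ r

lemma Xf_le (θ : ℝ) (q r : ℝ × ℝ) : |Xf θ q r| ≤ enorm2 q * enorm2 r := by
  refine abs_le_of_sq_le_sq ?_ (mul_nonneg (enorm2_nonneg q) (enorm2_nonneg r))
  rw [mul_pow, ← tn_sq θ q, ← tn_sq θ r]
  unfold Xf
  nlinarith [sq_nonneg (tq θ q * tq θ r - nq θ q * nq θ r)]

lemma tq_add (θ : ℝ) (q r : ℝ × ℝ) : tq θ (q + r) = tq θ q + tq θ r := by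
  simp [tq]; ring
lemma nq_add (θ : ℝ) (q r : ℝ × ℝ) : nq θ (q + r) = nq θ q + nq θ r := by
  simp [nq]; ring
lemma tq_sub (θ : ℝ) (q r : ℝ × ℝ) : tq θ (q - r) = tq θ q - tq θ r := by
  simp [tq]; ring
lemma nq_sub (θ : ℝ) (q r : ℝ × ℝ) : nq θ (q - r) = nq θ q - nq θ r := by
  simp [nq]; ring
lemma tq_rot (β α : ℝ) (q : ℝ × ℝ) :
    tq (β + α) q = Real.cos α * tq β q - Real.sin α * nq β q := by
  simp only [tq, nq, Real.sin_add, Real.cos_add]; ring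
lemma nq_rot (β α : ℝ) (q : ℝ × ℝ) :
    nq (β + α) q = Real.cos α * nq β q + Real.sin α * tq β q := by
  simp only [tq, nq, Real.sin_add, Real.cos_add]; ring
lemma tq_rot' (β α : ℝ) (q : ℝ × ℝ) :
    tq (β - α) q = Real.cos α * tq β q + Real.sin α * nq β q := by
  simp only [tq, nq, Real.sin_sub, Real.cos_sub]; ring
lemma nq_rot' (β α : ℝ) (q : ℝ × ℝ) :
    nq (β - α) q = Real.cos α * nq β q - Real.sin α * tq β q := by
  simp only [tq, nq, Real.sin_sub, Real.cos_sub]; ring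

lemma pt_identity (β α a b : ℝ) (w wp wm v : ℝ × ℝ) :
    Hf (β + α) a b (wp + w) v + Hf (β - α) a b (w + wm) v - Hf β a b (w + w) (v + v)
    = Hf β a b (wp - w - (w - wm)) v
      + -(a - b) * Real.sin α ^ 2 * Hf β 1 (-1) (wp + (w + w) + wm) v
      + -(a - b) * (Real.sin α * Real.cos α) * Xf β (wp - w + (w - wm)) v := by
  simp only [Hf, Xf, tq_rot, nq_rot, tq_rot', nq_rot', tq_add, nq_add, tq_sub, nq_sub]
  have h := Real.sin_sq_add_cos_sq α
  rw [show Real.cos α ^ 2 = 1 - Real.sin α ^ 2 by linarith] at *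
  have hc : Real.cos α ^ 2 = 1 - Real.sin α ^ 2 := by linarith [Real.sin_sq_add_cos_sq α]
  ring_nf
  rw [hc]
  ring

lemma per_cos (N : ℕ) (hN : 4 ≤ N) (ε : ℝ) (hε : ε = (N : ℝ)⁻¹) (ℓ : ℤ) :
    2 * π * ε * ((ℓ + (N : ℤ) : ℤ) : ℝ) = 2 * π * ε * ℓ + 2 * π := by
  have : (N : ℝ) ≠ 0 := by positivity
  push_cast
  rw [hε]; field_simp

lemma Hf_per (θ a b : ℝ) (q r : ℝ × ℝ) : Hf (θ + 2 * π) a b q r = Hf θ a b q r := by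
  simp [Hf, tq, nq]

lemma nrm_shift' (N : ℕ) (ε : ℝ) (v : ℤ → ℝ × ℝ) (hv : ∀ ℓ : ℤ, v (ℓ + (N : ℤ)) = v ℓ) :
    nrm N ε (fun ℓ => v (ℓ - 1)) = nrm N ε v := by
  have := nrm_shift N ε (fun ℓ => v (ℓ - 1))
    (fun ℓ => by beta_reduce; rw [show ℓ + (N : ℤ) - 1 = (ℓ - 1) + (N : ℤ) by ring, hv])
  rw [← this]; simp

lemma J_bound (N : ℕ) (ε : ℝ) (hε : 0 ≤ ε) (p q : ℤ → ℝ × ℝ) :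
    ε * ∑ ℓ ∈ Finset.Icc (1 : ℤ) (N : ℤ), enorm2 (p ℓ) * enorm2 (q ℓ)
      ≤ nrm N ε p * nrm N ε q := by
  have := cs_bound N ε hε 1 zero_le_one (fun ℓ => enorm2 (p ℓ) * enorm2 (q ℓ)) p q
    (fun ℓ => by
      rw [abs_of_nonneg (mul_nonneg (enorm2_nonneg _) (enorm2_nonneg _)), one_mul])
  rw [one_mul] at this
  exact (le_abs_self _).trans this

lemma bd_eq (ε : ℝ) (hε : ε ≠ 0) (w : ℤ → ℝ × ℝ) (ℓ : ℤ) : w ℓ - w (ℓ - 1) = ε • bd ε w ℓ := by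
  unfold bd; rw [smul_smul, mul_inv_cancel₀ hε, one_smul]

/-- The perturbation part of the Hessian difference. -/
lemma partD (N : ℕ) (ε : ℝ) (hε : 0 ≤ ε) (θ : ℤ → ℝ) (a b δ : ℝ) (ha : |a| ≤ δ) (hb : |b| ≤ δ)
    (w v : ℤ → ℝ × ℝ) (hw : ∀ ℓ : ℤ, w (ℓ + (N : ℤ)) = w ℓ)
    (hv : ∀ ℓ : ℤ, v (ℓ + (N : ℤ)) = v ℓ) :
    |ε * ∑ ℓ ∈ Finset.Icc (1 : ℤ) (N : ℤ), Hf (θ ℓ) a b (w (ℓ + 1) + w ℓ) (v (ℓ + 1) + v ℓ)|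
      ≤ 4 * δ * nrm N ε w * nrm N ε v := by
  have hδ : 0 ≤ δ := (abs_nonneg a).trans ha
  have hpt : ∀ ℓ, |Hf (θ ℓ) a b (w (ℓ + 1) + w ℓ) (v (ℓ + 1) + v ℓ)|
      ≤ δ * (enorm2 (w (ℓ + 1)) * enorm2 (v (ℓ + 1)) + enorm2 (w (ℓ + 1)) * enorm2 (v ℓ)
        + enorm2 (w ℓ) * enorm2 (v (ℓ + 1)) + enorm2 (w ℓ) * enorm2 (v ℓ)) := by
    intro ℓ
    refine (Hf_le _ _ _ δ ha hb _ _).trans ?_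
    have h1 := mul_le_mul (enorm2_add_le (w (ℓ + 1)) (w ℓ)) (enorm2_add_le (v (ℓ + 1)) (v ℓ))
      (enorm2_nonneg _) (add_nonneg (enorm2_nonneg _) (enorm2_nonneg _))
    exact (mul_le_mul_of_nonneg_left h1 hδ).trans (le_of_eq (by ring))
  have j1 := J_bound N ε hε (fun ℓ => w (ℓ + 1)) (fun ℓ => v (ℓ + 1))
  have j2 := J_bound N ε hε (fun ℓ => w (ℓ + 1)) v
  have j3 := J_bound N ε hε w (fun ℓ => v (ℓ + 1))
  have j4 := J_bound N ε hε w v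
  rw [nrm_shift N ε w hw] at j1 j2
  rw [nrm_shift N ε v hv] at j1 j3
  have hsum := (Finset.abs_sum_le_sum_abs _ (Finset.Icc (1 : ℤ) (N : ℤ))).trans
    (Finset.sum_le_sum fun ℓ (_ : ℓ ∈ Finset.Icc (1 : ℤ) (N : ℤ)) => hpt ℓ)
  rw [abs_mul, abs_of_nonneg hε]
  refine (mul_le_mul_of_nonneg_left hsum hε).trans ?_
  rw [← Finset.mul_sum]
  simp only [Finset.sum_add_distrib]
  calc _ = δ * (ε * ∑ ℓ ∈ Finset.Icc (1 : ℤ) (N : ℤ), enorm2 (w (ℓ + 1)) * enorm2 (v (ℓ + 1))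
        + ε * ∑ ℓ ∈ Finset.Icc (1 : ℤ) (N : ℤ), enorm2 (w (ℓ + 1)) * enorm2 (v ℓ)
        + ε * ∑ ℓ ∈ Finset.Icc (1 : ℤ) (N : ℤ), enorm2 (w ℓ) * enorm2 (v (ℓ + 1))
        + ε * ∑ ℓ ∈ Finset.Icc (1 : ℤ) (N : ℤ), enorm2 (w ℓ) * enorm2 (v ℓ)) := by ring
    _ ≤ δ * (nrm N ε w * nrm N ε v + nrm N ε w * nrm N ε v + nrm N ε w * nrm N ε v
        + nrm N ε w * nrm N ε v) := by gcongr
    _ = _ := by ring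

/-- The main part of the Hessian difference. -/
lemma partM (N : ℕ) (hN : 4 ≤ N) (ε : ℝ) (hε : ε = (N : ℝ)⁻¹) (a b m : ℝ)
    (ha : |a| ≤ m) (hb : |b| ≤ m)
    (w v : ℤ → ℝ × ℝ) (hw : ∀ ℓ : ℤ, w (ℓ + (N : ℤ)) = w ℓ)
    (hv : ∀ ℓ : ℤ, v (ℓ + (N : ℤ)) = v ℓ) :
    |ε * ∑ ℓ ∈ Finset.Icc (1 : ℤ) (N : ℤ),
        (Hf (2 * π * ε * ℓ) a b (w (ℓ + 1) + w ℓ) (v (ℓ + 1) + v ℓ)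
          - Hf (2 * π * ε * ℓ - π * ε) a b (w ℓ + w ℓ) (v ℓ + v ℓ))|
      ≤ (m * ε ^ 2 * nrm N ε (bd ε (bd ε w)) + 4 * π ^ 2 * |a - b| * ε ^ 2 * nrm N ε w
        + 2 * π * |a - b| * ε ^ 2 * nrm N ε (bd ε w)) * nrm N ε v := by
  have hε0 : 0 < ε := by rw [hε]; positivity
  have hm : 0 ≤ m := (abs_nonneg a).trans ha
  -- summation by parts
  have hshift : ∑ ℓ ∈ Finset.Icc (1 : ℤ) (N : ℤ), Hf (2 * π * ε * ℓ) a b (w (ℓ + 1) + w ℓ) (v (ℓ + 1))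
      = ∑ ℓ ∈ Finset.Icc (1 : ℤ) (N : ℤ),
        Hf (2 * π * ε * ℓ - π * ε - π * ε) a b (w ℓ + w (ℓ - 1)) (v ℓ) := by
    rw [← shift_sum N (fun ℓ => Hf (2 * π * ε * ℓ - π * ε - π * ε) a b (w ℓ + w (ℓ - 1)) (v ℓ))]
    · refine Finset.sum_congr rfl fun ℓ _ => ?_
      simp only [add_sub_cancel_right]
      congr 1
      push_cast; ring
    · intro ℓ
      beta_reduce
      rw [per_cos N hN ε hε, hw, hv, show ℓ + (N : ℤ) - 1 = (ℓ - 1) + (N : ℤ) by ring, hw,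
        show 2 * π * ε * ℓ + 2 * π - π * ε - π * ε = (2 * π * ε * ℓ - π * ε - π * ε) + 2 * π by ring,
        Hf_per]
  have hadd : ∀ θ q r s, Hf θ a b q (r + s) = Hf θ a b q r + Hf θ a b q s := by
    intro θ q r s; simp only [Hf, tq_add, nq_add]; ring
  have hre : ∑ ℓ ∈ Finset.Icc (1 : ℤ) (N : ℤ),
        (Hf (2 * π * ε * ℓ) a b (w (ℓ + 1) + w ℓ) (v (ℓ + 1) + v ℓ)
          - Hf (2 * π * ε * ℓ - π * ε) a b (w ℓ + w ℓ) (v ℓ + v ℓ))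
      = ∑ ℓ ∈ Finset.Icc (1 : ℤ) (N : ℤ),
        (Hf ((2 * π * ε * ℓ - π * ε) + π * ε) a b (w (ℓ + 1) + w ℓ) (v ℓ)
          + Hf ((2 * π * ε * ℓ - π * ε) - π * ε) a b (w ℓ + w (ℓ - 1)) (v ℓ)
          - Hf (2 * π * ε * ℓ - π * ε) a b (w ℓ + w ℓ) (v ℓ + v ℓ)) := by
    simp only [Finset.sum_sub_distrib, Finset.sum_add_distrib, sub_add_cancel]
    rw [← hshift, ← Finset.sum_add_distrib]
    congr 1
    refine Finset.sum_congr rfl fun ℓ _ => ?_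
    rw [hadd, add_comm]
  rw [hre]
  set W2 := bd ε w with hW2
  set W3 := bd ε W2 with hW3
  have hα : 0 ≤ π * ε := by positivity
  have hsin : |Real.sin (π * ε)| ≤ π * ε := by
    have := Real.abs_sin_le_abs (x := π * ε)
    rwa [abs_of_nonneg hα] at this
  have hsin2 : Real.sin (π * ε) ^ 2 ≤ π ^ 2 * ε ^ 2 := by
    rw [← mul_pow, ← sq_abs]; gcongr
  have hsc : |Real.sin (π * ε) * Real.cos (π * ε)| ≤ π * ε := by
    rw [abs_mul]
    calc _ ≤ (π * ε) * 1 := by gcongr; exact Real.abs_cos_le_one _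
      _ = _ := mul_one _
  have hpt : ∀ ℓ : ℤ, |Hf ((2 * π * ε * ℓ - π * ε) + π * ε) a b (w (ℓ + 1) + w ℓ) (v ℓ)
          + Hf ((2 * π * ε * ℓ - π * ε) - π * ε) a b (w ℓ + w (ℓ - 1)) (v ℓ)
          - Hf (2 * π * ε * ℓ - π * ε) a b (w ℓ + w ℓ) (v ℓ + v ℓ)|
      ≤ m * ε ^ 2 * (enorm2 (W3 (ℓ + 1)) * enorm2 (v ℓ))
        + |a - b| * (π ^ 2 * ε ^ 2) * (enorm2 (w (ℓ + 1)) * enorm2 (v ℓ))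
        + 2 * |a - b| * (π ^ 2 * ε ^ 2) * (enorm2 (w ℓ) * enorm2 (v ℓ))
        + |a - b| * (π ^ 2 * ε ^ 2) * (enorm2 (w (ℓ - 1)) * enorm2 (v ℓ))
        + |a - b| * (π * ε) * ε * (enorm2 (W2 (ℓ + 1)) * enorm2 (v ℓ))
        + |a - b| * (π * ε) * ε * (enorm2 (W2 ℓ) * enorm2 (v ℓ)) := by
    intro ℓ
    rw [pt_identity]
    set β := 2 * π * ε * ℓ - π * ε
    have e1 : w (ℓ + 1) - w ℓ = ε • W2 (ℓ + 1) := by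
      have := bd_eq ε hε0.ne' w (ℓ + 1)
      rwa [add_sub_cancel_right] at this
    have e2 : w ℓ - w (ℓ - 1) = ε • W2 ℓ := bd_eq ε hε0.ne' w ℓ
    have e3 : W2 (ℓ + 1) - W2 ℓ = ε • W3 (ℓ + 1) := by
      have := bd_eq ε hε0.ne' W2 (ℓ + 1)
      rwa [add_sub_cancel_right] at this
    have hvn := enorm2_nonneg (v ℓ)
    have t1 : |Hf β a b (w (ℓ + 1) - w ℓ - (w ℓ - w (ℓ - 1))) (v ℓ)|
        ≤ m * ε ^ 2 * (enorm2 (W3 (ℓ + 1)) * enorm2 (v ℓ)) := by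
      rw [e1, e2, ← smul_sub, e3]
      refine (Hf_le _ _ _ m ha hb _ _).trans (le_of_eq ?_)
      rw [enorm2_smul, enorm2_smul, abs_of_pos hε0]; ring
    have t2 : |-(a - b) * Real.sin (π * ε) ^ 2
          * Hf β 1 (-1) (w (ℓ + 1) + (w ℓ + w ℓ) + w (ℓ - 1)) (v ℓ)|
        ≤ |a - b| * (π ^ 2 * ε ^ 2) * ((enorm2 (w (ℓ + 1)) + (enorm2 (w ℓ) + enorm2 (w ℓ))
            + enorm2 (w (ℓ - 1))) * enorm2 (v ℓ)) := by
      rw [abs_mul, abs_mul, abs_neg, abs_of_nonneg (sq_nonneg (Real.sin (π * ε)))]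
      have h1 := Hf_le β 1 (-1) 1 (by simp) (by simp)
        (w (ℓ + 1) + (w ℓ + w ℓ) + w (ℓ - 1)) (v ℓ)
      rw [one_mul] at h1
      have h2 : enorm2 (w (ℓ + 1) + (w ℓ + w ℓ) + w (ℓ - 1))
          ≤ enorm2 (w (ℓ + 1)) + (enorm2 (w ℓ) + enorm2 (w ℓ)) + enorm2 (w (ℓ - 1)) :=
        (enorm2_add_le _ _).trans (by
          have := enorm2_add_le (w (ℓ + 1)) (w ℓ + w ℓ)
          have := enorm2_add_le (w ℓ) (w ℓ)
          linarith)
      have h3 := h1.trans (mul_le_mul_of_nonneg_right h2 hvn)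
      gcongr
    have t3 : |-(a - b) * (Real.sin (π * ε) * Real.cos (π * ε))
          * Xf β (w (ℓ + 1) - w ℓ + (w ℓ - w (ℓ - 1))) (v ℓ)|
        ≤ |a - b| * (π * ε) * (ε * (enorm2 (W2 (ℓ + 1)) + enorm2 (W2 ℓ)) * enorm2 (v ℓ)) := by
      rw [e1, e2, ← smul_add, abs_mul, abs_mul (-(a - b)), abs_neg]
      have h1 := Xf_le β (ε • (W2 (ℓ + 1) + W2 ℓ)) (v ℓ)
      rw [enorm2_smul, abs_of_pos hε0] at h1
      have h2 := enorm2_add_le (W2 (ℓ + 1)) (W2 ℓ)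
      have h3 : |Xf β (ε • (W2 (ℓ + 1) + W2 ℓ)) (v ℓ)|
          ≤ ε * (enorm2 (W2 (ℓ + 1)) + enorm2 (W2 ℓ)) * enorm2 (v ℓ) :=
        h1.trans (by gcongr)
      gcongr
    refine (abs_add_three _ _ _).trans ((add_le_add (add_le_add t1 t2) t3).trans (le_of_eq ?_))
    ring
  have hW2p := bd_per N ε w hw
  have hW3p := bd_per N ε W2 hW2p
  have j1 := J_bound N ε hε0.le (fun ℓ => W3 (ℓ + 1)) v
  have j2 := J_bound N ε hε0.le (fun ℓ => w (ℓ + 1)) v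
  have j3 := J_bound N ε hε0.le w v
  have j4 := J_bound N ε hε0.le (fun ℓ => w (ℓ - 1)) v
  have j5 := J_bound N ε hε0.le (fun ℓ => W2 (ℓ + 1)) v
  have j6 := J_bound N ε hε0.le W2 v
  rw [nrm_shift N ε W3 hW3p] at j1
  rw [nrm_shift N ε w hw] at j2
  rw [nrm_shift' N ε w hw] at j4
  rw [nrm_shift N ε W2 hW2p] at j5
  have hsum := (Finset.abs_sum_le_sum_abs _ (Finset.Icc (1 : ℤ) (N : ℤ))).trans
    (Finset.sum_le_sum fun ℓ (_ : ℓ ∈ Finset.Icc (1 : ℤ) (N : ℤ)) => hpt ℓ)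
  rw [abs_mul, abs_of_nonneg hε0.le]
  refine (mul_le_mul_of_nonneg_left hsum hε0.le).trans ?_
  simp only [Finset.sum_add_distrib, ← Finset.mul_sum]
  have hab := abs_nonneg (a - b)
  have k1 := mul_le_mul_of_nonneg_left j1 (show 0 ≤ m * ε ^ 2 by positivity)
  have k2 := mul_le_mul_of_nonneg_left j2 (show 0 ≤ |a - b| * (π ^ 2 * ε ^ 2) by positivity)
  have k3 := mul_le_mul_of_nonneg_left j3 (show 0 ≤ 2 * |a - b| * (π ^ 2 * ε ^ 2) by positivity)
  have k4 := mul_le_mul_of_nonneg_left j4 (show 0 ≤ |a - b| * (π ^ 2 * ε ^ 2) by positivity)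
  have k5 := mul_le_mul_of_nonneg_left j5 (show 0 ≤ |a - b| * (π * ε) * ε by positivity)
  have k6 := mul_le_mul_of_nonneg_left j6 (show 0 ≤ |a - b| * (π * ε) * ε by positivity)
  refine le_trans (le_of_eq ?_) ((add_le_add (add_le_add (add_le_add (add_le_add
    (add_le_add k1 k2) k3) k4) k5) k6).trans (le_of_eq ?_))
  · ring
  · ring

lemma nrm_tan (N : ℕ) (hN : 4 ≤ N) (ε : ℝ) (hε : ε = (N : ℝ)⁻¹) :
    nrm N ε (fun _ => tv 0) = 1 := by
  have h1 : enorm2 (tv 0) = 1 := by simpa using enorm2_tv 1 0 one_pos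
  have : (N : ℝ) ≠ 0 := by positivity
  unfold nrm
  simp [h1, hε, this]

lemma tan_sum_le (N : ℕ) (hN : 4 ≤ N) (ε : ℝ) (hε : ε = (N : ℝ)⁻¹) (θ : ℤ → ℝ)
    (v : ℤ → ℝ × ℝ) :
    |ε * ∑ ℓ ∈ Finset.Icc (1 : ℤ) (N : ℤ), tq (θ ℓ) (v ℓ)| ≤ nrm N ε v := by
  have hε0 : 0 ≤ ε := by rw [hε]; positivity
  have h1 : enorm2 (tv 0) = 1 := by simpa using enorm2_tv 1 0 one_pos
  have := cs_bound N ε hε0 1 zero_le_one (fun ℓ => tq (θ ℓ) (v ℓ)) (fun _ => tv 0) v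
    (fun ℓ => by simpa [h1] using tq_le (θ ℓ) (v ℓ))
  simpa [nrm_tan N hN ε hε] using this

lemma tan_shift (N : ℕ) (hN : 4 ≤ N) (ε : ℝ) (hε : ε = (N : ℝ)⁻¹)
    (v : ℤ → ℝ × ℝ) (hv : ∀ ℓ : ℤ, v (ℓ + (N : ℤ)) = v ℓ) :
    ∑ ℓ ∈ Finset.Icc (1 : ℤ) (N : ℤ), tq (2 * π * ε * ℓ) (v (ℓ + 1) + v ℓ)
      = 2 * Real.cos (π * ε) *
        ∑ ℓ ∈ Finset.Icc (1 : ℤ) (N : ℤ), tq (2 * π * ε * ℓ - π * ε) (v ℓ) := by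
  have hshift : ∑ ℓ ∈ Finset.Icc (1 : ℤ) (N : ℤ), tq (2 * π * ε * ℓ) (v (ℓ + 1))
      = ∑ ℓ ∈ Finset.Icc (1 : ℤ) (N : ℤ), tq (2 * π * ε * ℓ - π * ε - π * ε) (v ℓ) := by
    rw [← shift_sum N (fun ℓ => tq (2 * π * ε * ℓ - π * ε - π * ε) (v ℓ))]
    · refine Finset.sum_congr rfl fun ℓ _ => ?_
      congr 1
      push_cast; ring
    · intro ℓ
      rw [per_cos N hN ε hε, hv,
        show 2 * π * ε * ℓ + 2 * π - π * ε - π * ε = (2 * π * ε * ℓ - π * ε - π * ε) + 2 * π by ring]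
      simp [tq]
  simp only [tq_add, Finset.sum_add_distrib]
  rw [hshift, ← Finset.sum_add_distrib, Finset.mul_sum]
  refine Finset.sum_congr rfl fun ℓ _ => ?_
  have h := tq_rot (2 * π * ε * ℓ - π * ε) (π * ε) (v ℓ)
  rw [sub_add_cancel] at h
  rw [h, tq_rot']
  ring

set_option maxHeartbeats 1000000 in
theorem stmt_13 (N : ℕ) (hN : 4 ≤ N) (ε : ℝ) (hε : ε = (N : ℝ)⁻¹)
    (φ : ℝ → ℝ) (hφ : ContDiffOn ℝ 3 φ (Set.Ioi 0)) (F : ℝ) (hF : 0 < F)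
    (hγ : 0 < min (deriv (deriv φ) F + 4 * deriv (deriv φ) (2 * F))
      ((deriv φ F + 2 * deriv φ (2 * F)) / F))
    (Cφ : ℝ) (hCφ0 : 0 < Cφ)
    (hCφ : max |deriv (deriv φ) (2 * (F * Real.cos (π * ε))) - deriv (deriv φ) (2 * F)|
        |deriv φ (2 * (F * Real.cos (π * ε))) / (2 * (F * Real.cos (π * ε)))
          - deriv φ (2 * F) / (2 * F)| ≤ Cφ * ε ^ 2)
    (C1 C2 Cκ : ℝ)
    (hC1 : C1 = max (max |deriv (deriv φ) (2 * F)| |deriv φ (2 * F) / (2 * F)|)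
      (4 * π ^ 2 * |deriv (deriv φ) (2 * F) - deriv φ (2 * F) / (2 * F)| + 12 * Cφ))
    (hC2 : C2 = 4 * π * Cφ)
    (hCκ : Cκ = 4 * Cφ * (1 + π ^ 2 * ε ^ 2) * F + 2 * π ^ 2 * |deriv φ (2 * F)|)
    (f ua uCB : ℤ → ℝ × ℝ) (hf : IsDisp N f) (hua : IsDisp N ua) (huCB : IsDisp N uCB)
    (heqa : ∀ v : ℤ → ℝ × ℝ, IsDisp N v →
      dE (Ea N ε φ) (yCirc ε F) v + d2E (Ea N ε φ) (yCirc ε F) ua v = ip N ε f v)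
    (heqCB : ∀ v : ℤ → ℝ × ℝ, IsDisp N v →
      dE (ECB N ε φ) (yCirc ε F) v + d2E (ECB N ε φ) (yCirc ε F) uCB v = ip N ε f v) :
    nrm N ε (bd ε (fun ℓ => ua ℓ - uCB ℓ)) ≤
      (min (deriv (deriv φ) F + 4 * deriv (deriv φ) (2 * F))
        ((deriv φ F + 2 * deriv φ (2 * F)) / F))⁻¹ *
      (Cκ * ε ^ 2 + (C1 * ε ^ 2 + C2 * ε ^ 4) *
        (nrm N ε (bd ε (bd ε (bd ε ua))) + nrm N ε (bd ε (bd ε ua)) + nrm N ε (bd ε ua))) := by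
  obtain ⟨hup, -⟩ := id hua
  obtain ⟨hcp, -⟩ := id huCB
  have hNr : (4 : ℝ) ≤ N := by exact_mod_cast hN
  have hε0 : 0 < ε := by rw [hε]; positivity
  have hε4 : ε ≤ 1 / 4 := by
    rw [hε, inv_eq_one_div]; exact one_div_le_one_div_of_le (by norm_num) hNr
  have hα0 : 0 < π * ε := by positivity
  have hα4 : π * ε ≤ π / 4 := by nlinarith [Real.pi_pos]
  have hs : Real.sin (π * ε) ≠ 0 :=
    (Real.sin_pos_of_pos_of_lt_pi hα0 (by linarith [Real.pi_pos])).ne'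
  have hc : 0 < Real.cos (π * ε) :=
    Real.cos_pos_of_mem_Ioo ⟨by linarith, by linarith [Real.pi_pos]⟩
  have hF2 : 0 < 2 * (F * Real.cos (π * ε)) := by positivity
  have h2F : 0 < 2 * F := by positivity
  set e : ℤ → ℝ × ℝ := fun ℓ => ua ℓ - uCB ℓ with he
  have heD : IsDisp N e := by
    refine ⟨fun ℓ => by simp [he, hup, hcp], ?_⟩
    simp only [he, Finset.sum_sub_distrib, hua.2, huCB.2, sub_zero]
  have hA := bd_lin ε
  have hB : ∀ (y u : ℤ → ℝ × ℝ) (t : ℝ) (ℓ : ℤ),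
      (fun (y : ℤ → ℝ × ℝ) (ℓ : ℤ) => bd ε y (ℓ + 1) + bd ε y ℓ) (fun k => y k + t • u k) ℓ
      = (fun (y : ℤ → ℝ × ℝ) (ℓ : ℤ) => bd ε y (ℓ + 1) + bd ε y ℓ) y ℓ
        + t • (fun (y : ℤ → ℝ × ℝ) (ℓ : ℤ) => bd ε y (ℓ + 1) + bd ε y ℓ) u ℓ := by
    intro y u t ℓ
    beta_reduce
    rw [hA, hA, smul_add]; abel
  have hC : ∀ (y u : ℤ → ℝ × ℝ) (t : ℝ) (ℓ : ℤ),
      (fun (y : ℤ → ℝ × ℝ) (ℓ : ℤ) => bd ε y ℓ + bd ε y ℓ) (fun k => y k + t • u k) ℓ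
      = (fun (y : ℤ → ℝ × ℝ) (ℓ : ℤ) => bd ε y ℓ + bd ε y ℓ) y ℓ
        + t • (fun (y : ℤ → ℝ × ℝ) (ℓ : ℤ) => bd ε y ℓ + bd ε y ℓ) u ℓ := by
    intro y u t ℓ
    beta_reduce
    rw [hA, smul_add]; abel
  have hEa : ∀ y, Ea N ε φ y = ε * ∑ ℓ ∈ Finset.Icc (1 : ℤ) (N : ℤ),
      (φ (enorm2 (bd ε y ℓ)) +
        φ (enorm2 ((fun (y : ℤ → ℝ × ℝ) (ℓ : ℤ) => bd ε y (ℓ + 1) + bd ε y ℓ) y ℓ))) :=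
    fun y => rfl
  have hEC : ∀ y, ECB N ε φ y = ε * ∑ ℓ ∈ Finset.Icc (1 : ℤ) (N : ℤ),
      (φ (enorm2 (bd ε y ℓ)) +
        φ (enorm2 ((fun (y : ℤ → ℝ × ℝ) (ℓ : ℤ) => bd ε y ℓ + bd ε y ℓ) y ℓ))) := by
    intro y; simp only [ECB, two_enorm2]
  have yA := bd_circ ε F hε0.ne' hs
  have yB := bd_circ2 ε F hε0.ne' hs
  have yC : ∀ ℓ : ℤ, bd ε (yCirc ε F) ℓ + bd ε (yCirc ε F) ℓ
      = (2 * F) • tv (2 * π * ε * ℓ - π * ε) := by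
    intro ℓ; rw [yA, ← two_smul ℝ, smul_smul]
  have pA : ∀ ℓ ∈ Finset.Icc (1 : ℤ) (N : ℤ), 0 < enorm2 (bd ε (yCirc ε F) ℓ) := by
    intro ℓ _; rw [yA, enorm2_tv _ _ hF]; exact hF
  have pB : ∀ ℓ ∈ Finset.Icc (1 : ℤ) (N : ℤ), 0 < enorm2
      ((fun (y : ℤ → ℝ × ℝ) (ℓ : ℤ) => bd ε y (ℓ + 1) + bd ε y ℓ) (yCirc ε F) ℓ) := by
    intro ℓ _; beta_reduce; rw [yB, enorm2_tv _ _ hF2]; exact hF2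
  have pC : ∀ ℓ ∈ Finset.Icc (1 : ℤ) (N : ℤ), 0 < enorm2
      ((fun (y : ℤ → ℝ × ℝ) (ℓ : ℤ) => bd ε y ℓ + bd ε y ℓ) (yCirc ε F) ℓ) := by
    intro ℓ _; beta_reduce; rw [yC, enorm2_tv _ _ h2F]; exact h2F
  have hQa := heqa e heD
  have hQc := heqCB e heD
  rw [var1 _ ε φ hφ _ _ _ hEa hA hB _ e pA pB, var2 _ ε φ hφ _ _ _ hEa hA hB _ ua e pA pB] at hQa
  rw [var1 _ ε φ hφ _ _ _ hEC hA hC _ e pA pC, var2 _ ε φ hφ _ _ _ hEC hA hC _ uCB e pA pC] at hQc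
  simp only [yB] at hQa
  simp only [yA, Gb_tv φ F _ hF, Gb_tv φ _ _ hF2, Kb_tv φ F _ hF, Kb_tv φ _ _ hF2] at hQa
  simp only [yC] at hQc
  simp only [yA, Gb_tv φ F _ hF, Gb_tv φ _ _ h2F, Kb_tv φ F _ hF, Kb_tv φ _ _ h2F] at hQc
  have hep : ∀ ℓ : ℤ, bd ε e (ℓ + (N : ℤ)) = bd ε e ℓ := bd_per N ε e heD.1
  have hwp : ∀ ℓ : ℤ, bd ε ua (ℓ + (N : ℤ)) = bd ε ua ℓ := bd_per N ε ua hup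
  have hbe : ∀ ℓ, bd ε uCB ℓ = bd ε ua ℓ - bd ε e ℓ := by
    intro ℓ; simp only [bd, he]; rw [← smul_sub]; congr 1; abel
  simp only [hbe] at hQc
  set v := bd ε e with hv
  set w := bd ε ua with hw
  set S := Finset.Icc (1 : ℤ) (N : ℤ) with hS
  set a := deriv (deriv φ) (2 * F) with ha
  set b := deriv φ (2 * F) / (2 * F) with hb
  set a2 := deriv (deriv φ) (2 * (F * Real.cos (π * ε))) with ha2
  set b2 := deriv φ (2 * (F * Real.cos (π * ε))) / (2 * (F * Real.cos (π * ε))) with hb2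
  have hδa : |a2 - a| ≤ Cφ * ε ^ 2 := (le_max_left _ _).trans hCφ
  have hδb : |b2 - b| ≤ Cφ * ε ^ 2 := (le_max_right _ _).trans hCφ
  set γ := min (deriv (deriv φ) F + 4 * a) ((deriv φ F + 2 * deriv φ (2 * F)) / F) with hγd
  -- the abstract sums
  set T := ∑ ℓ ∈ S, tq (2 * π * ε * ℓ - π * ε) (v ℓ) with hT
  set X := ∑ ℓ ∈ S, Hf (2 * π * ε * ℓ - π * ε) (deriv (deriv φ) F) (deriv φ F / F) (w ℓ) (v ℓ)
    with hX
  have hD := partD N ε hε0.le (fun ℓ => 2 * π * ε * ℓ) (a2 - a) (b2 - b) (Cφ * ε ^ 2) hδa hδb w v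
    hwp hep
  have hM := partM N hN ε hε a b (max |a| |b|) (le_max_left _ _) (le_max_right _ _) w v hwp hep
  set SD := ∑ ℓ ∈ S, Hf (2 * π * ε * ℓ) (a2 - a) (b2 - b) (w (ℓ + 1) + w ℓ) (v (ℓ + 1) + v ℓ)
    with hSD
  set SM := ∑ ℓ ∈ S, (Hf (2 * π * ε * ℓ) a b (w (ℓ + 1) + w ℓ) (v (ℓ + 1) + v ℓ)
          - Hf (2 * π * ε * ℓ - π * ε) a b (w ℓ + w ℓ) (v ℓ + v ℓ)) with hSM
  set Z := ∑ ℓ ∈ S, Hf (2 * π * ε * ℓ - π * ε) a b (w ℓ + w ℓ) (v ℓ + v ℓ) with hZ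
  set Q := ∑ ℓ ∈ S, (Hf (2 * π * ε * ℓ - π * ε) (deriv (deriv φ) F) (deriv φ F / F) (v ℓ) (v ℓ)
    + Hf (2 * π * ε * ℓ - π * ε) a b (v ℓ + v ℓ) (v ℓ + v ℓ)) with hQ
  have r1 : ∑ ℓ ∈ S, (deriv φ F * tq (2 * π * ε * ℓ - π * ε) (v ℓ)
      + deriv φ (2 * (F * Real.cos (π * ε))) * tq (2 * π * ε * ℓ) (v (ℓ + 1) + v ℓ))
      = (deriv φ F + 2 * Real.cos (π * ε) * deriv φ (2 * (F * Real.cos (π * ε)))) * T := by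
    rw [Finset.sum_add_distrib, ← Finset.mul_sum, ← Finset.mul_sum, tan_shift N hN ε hε v hep]
    ring
  have r2 : ∑ ℓ ∈ S, (deriv φ F * tq (2 * π * ε * ℓ - π * ε) (v ℓ)
      + deriv φ (2 * F) * tq (2 * π * ε * ℓ - π * ε) (v ℓ + v ℓ))
      = (deriv φ F + 2 * deriv φ (2 * F)) * T := by
    rw [hT, Finset.mul_sum]
    refine Finset.sum_congr rfl fun ℓ _ => ?_
    rw [tq_add]; ring
  have r3 : ∑ ℓ ∈ S, (Hf (2 * π * ε * ℓ - π * ε) (deriv (deriv φ) F) (deriv φ F / F) (w ℓ) (v ℓ)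
      + Hf (2 * π * ε * ℓ) a2 b2 (w (ℓ + 1) + w ℓ) (v (ℓ + 1) + v ℓ)) = X + SD + SM + Z := by
    rw [hX, hSD, hSM, hZ, ← Finset.sum_add_distrib, ← Finset.sum_add_distrib,
      ← Finset.sum_add_distrib]
    refine Finset.sum_congr rfl fun ℓ _ => ?_
    simp only [Hf]; ring
  have r4 : ∑ ℓ ∈ S, (Hf (2 * π * ε * ℓ - π * ε) (deriv (deriv φ) F) (deriv φ F / F)
        (w ℓ - v ℓ) (v ℓ)
      + Hf (2 * π * ε * ℓ - π * ε) a b (w ℓ - v ℓ + (w ℓ - v ℓ)) (v ℓ + v ℓ)) = X + Z - Q := by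
    rw [hX, hZ, hQ, ← Finset.sum_add_distrib, ← Finset.sum_sub_distrib]
    refine Finset.sum_congr rfl fun ℓ _ => ?_
    simp only [Hf, tq_add, nq_add, tq_sub, nq_sub]; ring
  rw [r1, r3] at hQa
  rw [r2, r4] at hQc
  have hQlow : γ * nrm N ε v ^ 2 ≤ ε * Q := by
    rw [nrm_sq N ε hε0.le, hQ]
    have : γ * ∑ ℓ ∈ S, enorm2 (v ℓ) ^ 2 ≤ Q := by
      rw [hQ, Finset.mul_sum]
      refine Finset.sum_le_sum fun ℓ _ => ?_
      have h1 := Hf_ge (2 * π * ε * ℓ - π * ε) (deriv (deriv φ) F + 4 * a)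
        ((deriv φ F + 2 * deriv φ (2 * F)) / F) γ (min_le_left _ _) (min_le_right _ _) (v ℓ)
      refine h1.trans (le_of_eq ?_)
      have h2 : (deriv φ F + 2 * deriv φ (2 * F)) / F = deriv φ F / F + 4 * b := by
        rw [hb]; field_simp; ring
      rw [h2]
      simp only [Hf, tq_add, nq_add]; ring
    calc _ = ε * (γ * ∑ ℓ ∈ S, enorm2 (v ℓ) ^ 2) := by ring
      _ ≤ _ := by gcongr
  have hTle : |ε * T| ≤ nrm N ε v := tan_sum_le N hN ε hε (fun ℓ => 2 * π * ε * ℓ - π * ε) v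
  have hsin : |Real.sin (π * ε)| ≤ π * ε := by
    have := Real.abs_sin_le_abs (x := π * ε)
    rwa [abs_of_pos hα0] at this
  have hsin2 : Real.sin (π * ε) ^ 2 ≤ π ^ 2 * ε ^ 2 := by
    rw [← mul_pow, ← sq_abs]; gcongr
  -- force difference
  have hforce : |2 * deriv φ (2 * F)
      - 2 * Real.cos (π * ε) * deriv φ (2 * (F * Real.cos (π * ε)))| ≤ Cκ * ε ^ 2 := by
    have e1 : 2 * deriv φ (2 * F)
      - 2 * Real.cos (π * ε) * deriv φ (2 * (F * Real.cos (π * ε)))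
      = 2 * deriv φ (2 * F) * Real.sin (π * ε) ^ 2
        + -(4 * F * Real.cos (π * ε) ^ 2) * (b2 - b) := by
      have q1 : deriv φ (2 * (F * Real.cos (π * ε))) = b2 * (2 * (F * Real.cos (π * ε))) := by
        rw [hb2, div_mul_cancel₀ _ hF2.ne']
      have q2 : deriv φ (2 * F) = b * (2 * F) := by
        rw [hb, div_mul_cancel₀ _ h2F.ne']
      rw [q1, q2]
      linear_combination (-(4 * b * F)) * Real.sin_sq_add_cos_sq (π * ε)
    rw [e1]
    refine (abs_add_le _ _).trans ?_
    have hc2 : Real.cos (π * ε) ^ 2 ≤ 1 := Real.cos_sq_le_one _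
    have u1 : |2 * deriv φ (2 * F) * Real.sin (π * ε) ^ 2|
        ≤ 2 * |deriv φ (2 * F)| * (π ^ 2 * ε ^ 2) := by
      rw [abs_mul, abs_mul, abs_two, abs_of_nonneg (sq_nonneg (Real.sin (π * ε)))]
      gcongr
    have u2 : |-(4 * F * Real.cos (π * ε) ^ 2) * (b2 - b)| ≤ (4 * F * 1) * (Cφ * ε ^ 2) := by
      rw [abs_mul, abs_neg, abs_of_nonneg (by positivity : 0 ≤ 4 * F * Real.cos (π * ε) ^ 2)]
      gcongr
    have u3 : 0 ≤ 4 * Cφ * (π ^ 2 * ε ^ 2) * F * ε ^ 2 := by positivity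
    rw [hCκ]
    linarith
  set n := nrm N ε v with hn
  have hn0 : 0 ≤ n := nrm_nonneg _ _ _
  set n1 := nrm N ε w with hn1
  set n2 := nrm N ε (bd ε w) with hn2
  set n3 := nrm N ε (bd ε (bd ε w)) with hn3
  have h1n : 0 ≤ n1 := nrm_nonneg _ _ _
  have h2n : 0 ≤ n2 := nrm_nonneg _ _ _
  have h3n : 0 ≤ n3 := nrm_nonneg _ _ _
  set R := Cκ * ε ^ 2 + (C1 * ε ^ 2 + C2 * ε ^ 4) * (n3 + n2 + n1) with hR
  have hkey : γ * n ^ 2 ≤ R * n := by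
    have hid : ε * Q = (2 * deriv φ (2 * F)
      - 2 * Real.cos (π * ε) * deriv φ (2 * (F * Real.cos (π * ε)))) * (ε * T)
      - ε * SD - ε * SM := by linear_combination hQa - hQc
    have f1 : (2 * deriv φ (2 * F)
      - 2 * Real.cos (π * ε) * deriv φ (2 * (F * Real.cos (π * ε)))) * (ε * T)
      ≤ Cκ * ε ^ 2 * n := by
      refine (le_abs_self _).trans ?_
      rw [abs_mul]
      exact mul_le_mul hforce hTle (abs_nonneg _) ((abs_nonneg _).trans hforce)
    have f2 := (neg_le_abs (ε * SD)).trans hD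
    have f3 := (neg_le_abs (ε * SM)).trans hM
    have hab := abs_nonneg (a - b)
    have m1 : max |a| |b| ≤ C1 := by rw [hC1]; exact le_max_left _ _
    have m2 : 4 * π ^ 2 * |a - b| + 12 * Cφ ≤ C1 := by rw [hC1]; exact le_max_right _ _
    have m3 : 2 * π * |a - b| ≤ C1 := by
      have : 2 * π * |a - b| ≤ 4 * π ^ 2 * |a - b| := by
        have : 2 * π ≤ 4 * π ^ 2 := by nlinarith [Real.pi_gt_three]
        gcongr
      linarith
    have m4 : 4 * π ^ 2 * |a - b| + 4 * Cφ ≤ C1 := by linarith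
    have g : max |a| |b| * ε ^ 2 * n3 + 4 * π ^ 2 * |a - b| * ε ^ 2 * n1
        + 2 * π * |a - b| * ε ^ 2 * n2 + 4 * (Cφ * ε ^ 2) * n1
        ≤ (C1 * ε ^ 2 + C2 * ε ^ 4) * (n3 + n2 + n1) := by
      have hC2p : 0 ≤ C2 * ε ^ 4 * (n3 + n2 + n1) := by rw [hC2]; positivity
      have g1 : max |a| |b| * (ε ^ 2 * n3) ≤ C1 * (ε ^ 2 * n3) := by gcongr
      have g2 : 2 * π * |a - b| * (ε ^ 2 * n2) ≤ C1 * (ε ^ 2 * n2) := by gcongr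
      have g3 : (4 * π ^ 2 * |a - b| + 4 * Cφ) * (ε ^ 2 * n1) ≤ C1 * (ε ^ 2 * n1) := by gcongr
      linarith
    have g' := mul_le_mul_of_nonneg_right g hn0
    rw [hR]
    linarith
  rw [inv_mul_eq_div, le_div_iff₀ hγ]
  rcases hn0.eq_or_lt with h0 | hpos
  · have hCk : 0 ≤ Cκ * ε ^ 2 := (abs_nonneg _).trans hforce
    have hC1p : 0 ≤ C1 := by
      rw [hC1]; exact (abs_nonneg a).trans ((le_max_left _ _).trans (le_max_left _ _))
    have : 0 ≤ R := by rw [hR, hC2]; positivity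
    rw [← h0, zero_mul]; exact this
  · refine le_of_mul_le_mul_right ?_ hpos
    linarith
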